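/- Let a > 0. There exist C > 0 and K ∈ ℕ such that for all k ≥ K, | (2k)^{1/4}·√(aπ)·e^{−2^{3/2}a√k} · ∫_ℝ e^{2a√(1+x²)} h_k(x)² dx − 1 | ≤ C·k^{−1/2}. Equivalently, ∫_ℝ e^{2a√(1+x²)} h_k(x)² dx = ((2k)^{1/4}√(aπ))^{−1}·exp(2^{3/2}a√k)·(1 + O(k^{−1/2})) as k → ∞. -/

import Mathlib

open MeasureTheory

/-- The physicists' Hermite polynomial `H_k` on `ℝ`. -/
noncomputable def physHermiteR (k : ℕ) (x : ℝ) : ℝ :=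
  (-1) ^ k * Real.exp (x ^ 2) * iteratedDeriv k (fun t : ℝ => Real.exp (-t ^ 2)) x

/-- The Hermite function `h_k` on `ℝ`. -/
noncomputable def hermiteFunR (k : ℕ) (x : ℝ) : ℝ :=
  (Real.sqrt (2 ^ k * Nat.factorial k * Real.sqrt Real.pi))⁻¹ *
    physHermiteR k x * Real.exp (-x ^ 2 / 2)

section HermitePolynomial

open Polynomial

/-- The physicists' Hermite polynomials as elements of `ℝ[X]`, defined by their raising recursion. -/
noncomputable def physHermitePoly : ℕ → ℝ[X]
  | 0 => 1
  | n + 1 => 2 * X * physHermitePoly n - derivative (physHermitePoly n)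

theorem physHermitePoly_succ (n : ℕ) :
    physHermitePoly (n + 1) = 2 * X * physHermitePoly n - derivative (physHermitePoly n) := rfl

theorem iteratedDeriv_gaussian (n : ℕ) (x : ℝ) :
    iteratedDeriv n (fun t : ℝ => Real.exp (-t ^ 2)) x =
      (-1) ^ n * (physHermitePoly n).eval x * Real.exp (-x ^ 2) := by
  induction n generalizing x with
  | zero => simp [physHermitePoly]
  | succ n ih =>
    rw [iteratedDeriv_succ, funext ih]
    have hexp : HasDerivAt (fun x : ℝ => Real.exp (-x ^ 2)) (Real.exp (-x ^ 2) * (-(2 * x))) x := by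
      simpa using ((hasDerivAt_pow 2 x).neg).exp
    have h := (((physHermitePoly n).hasDerivAt x).const_mul ((-1 : ℝ) ^ n)).mul hexp
    refine h.deriv.trans ?_
    simp only [physHermitePoly_succ, eval_sub, eval_mul, eval_X, eval_ofNat]
    ring

theorem physHermiteR_eq_eval (n : ℕ) (x : ℝ) :
    physHermiteR n x = (physHermitePoly n).eval x := by
  rw [physHermiteR, iteratedDeriv_gaussian, Real.exp_neg]
  have h : ((-1 : ℝ) ^ n) * (-1) ^ n = 1 := by rw [← mul_pow]; simp
  field_simp
  linear_combination (eval x (physHermitePoly n)) * h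

theorem derivative_physHermitePoly_succ (n : ℕ) :
    derivative (physHermitePoly (n + 1)) = (2 * (n + 1) : ℝ) • physHermitePoly n := by
  induction n with
  | zero => simp [physHermitePoly, smul_eq_C_mul, map_ofNat]
  | succ n ih =>
    rw [physHermitePoly_succ (n + 1), derivative_sub, derivative_mul, ih, derivative_smul]
    have h := physHermitePoly_succ n
    simp only [smul_eq_C_mul, derivative_mul, derivative_X, derivative_ofNat] at *
    rw [show derivative (physHermitePoly n) = 2 * X * physHermitePoly n - physHermitePoly (n + 1) by
      rw [h]; ring]
    push_cast
    simp only [map_mul, map_add, map_natCast, map_ofNat, map_one]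
    ring

theorem iterate_derivative_physHermitePoly (j m : ℕ) :
    derivative^[j] (physHermitePoly (m + j)) =
      (2 ^ j * ((m + j).factorial / m.factorial) : ℝ) • physHermitePoly m := by
  induction j with
  | zero => simp [Nat.factorial_ne_zero]
  | succ j ih =>
    rw [Function.iterate_succ_apply, ← add_assoc, derivative_physHermitePoly_succ,
      iterate_derivative_smul, ih, smul_smul]
    congr 1
    rw [Nat.factorial_succ]
    push_cast
    ring

/-- Integration of a polynomial against the shifted Gaussian weight `exp (2 b x - x ^ 2)`. -/
noncomputable def gaussMoment (b : ℝ) (p : ℝ[X]) : ℝ :=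
  ∫ x : ℝ, p.eval x * Real.exp (2 * b * x - x ^ 2)

theorem integrable_eval_mul_exp_neg_sq (p : ℝ[X]) :
    Integrable fun x : ℝ => p.eval x * Real.exp (-x ^ 2) := by
  induction p using Polynomial.induction_on' with
  | add p q hp hq =>
    refine (hp.add hq).congr (.of_forall fun x => ?_)
    simp [add_mul]
  | monomial n c =>
    have h := integrable_rpow_mul_exp_neg_mul_sq (b := 1) one_pos (s := n)
      (by linarith [Nat.cast_nonneg (α := ℝ) n])
    refine (h.const_mul c).congr (.of_forall fun x => ?_)
    simp [mul_assoc]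

theorem integrable_eval_mul_exp (b : ℝ) (p : ℝ[X]) :
    Integrable fun x : ℝ => p.eval x * Real.exp (2 * b * x - x ^ 2) := by
  have h := ((integrable_eval_mul_exp_neg_sq (p.comp (X + C b))).comp_sub_right b).const_mul
    (Real.exp (b ^ 2))
  refine h.congr (.of_forall fun x => ?_)
  have hx : 2 * b * x - x ^ 2 = b ^ 2 + -(x - b) ^ 2 := by ring
  simp only [hx, Real.exp_add, eval_comp, eval_add, eval_X, eval_C, sub_add_cancel]
  ring

theorem gaussMoment_add (b : ℝ) (p q : ℝ[X]) :
    gaussMoment b (p + q) = gaussMoment b p + gaussMoment b q := by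
  simp only [gaussMoment, eval_add, add_mul]
  exact integral_add (integrable_eval_mul_exp b p) (integrable_eval_mul_exp b q)

theorem gaussMoment_smul (b c : ℝ) (p : ℝ[X]) :
    gaussMoment b (c • p) = c * gaussMoment b p := by
  simp only [gaussMoment, eval_smul, smul_eq_mul, mul_assoc]
  exact integral_const_mul _ _

theorem gaussMoment_sum (b : ℝ) {ι : Type*} (s : Finset ι) (f : ι → ℝ[X]) :
    gaussMoment b (∑ i ∈ s, f i) = ∑ i ∈ s, gaussMoment b (f i) :=
  map_sum (⟨⟨gaussMoment b, by simp [gaussMoment]⟩, gaussMoment_add b⟩ : ℝ[X] →+ ℝ) f s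

theorem gaussMoment_one (b : ℝ) : gaussMoment b 1 = Real.sqrt Real.pi * Real.exp (b ^ 2) := by
  have h : ∀ x : ℝ, (1 : ℝ[X]).eval x * Real.exp (2 * b * x - x ^ 2) =
      Real.exp (b ^ 2) * Real.exp (-1 * (x - b) ^ 2) := fun x => by
    rw [eval_one, one_mul, ← Real.exp_add]; ring_nf
  simp only [gaussMoment, h]
  rw [integral_const_mul, integral_sub_right_eq_self (fun x : ℝ => Real.exp (-1 * x ^ 2)) b,
    integral_gaussian, div_one, mul_comm]

/-- Integration by parts against the shifted Gaussian weight. -/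
theorem gaussMoment_raising (b : ℝ) (p : ℝ[X]) :
    gaussMoment b (2 * X * p - derivative p) = 2 * b * gaussMoment b p := by
  have hz : gaussMoment b (derivative p + (2 * b) • p + (-1 : ℝ) • (2 * X * p)) = 0 := by
    refine integral_eq_zero_of_hasDerivAt_of_integrable
      (f := fun x => p.eval x * Real.exp (2 * b * x - x ^ 2)) (fun x => ?_)
      (integrable_eval_mul_exp b _) (integrable_eval_mul_exp b _)
    have he : HasDerivAt (fun x : ℝ => Real.exp (2 * b * x - x ^ 2))
        (Real.exp (2 * b * x - x ^ 2) * (2 * b - 2 * x)) x := by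
      simpa using (((hasDerivAt_id x).const_mul (2 * b)).sub (hasDerivAt_pow 2 x)).exp
    refine ((p.hasDerivAt x).mul he).congr_deriv ?_
    simp only [eval_add, eval_smul, eval_mul, eval_X, eval_ofNat, smul_eq_mul]
    ring
  have hs : 2 * X * p - derivative p =
      (-1 : ℝ) • (derivative p + (2 * b) • p + (-1 : ℝ) • (2 * X * p)) + (2 * b) • p := by
    module
  rw [hs, gaussMoment_add, gaussMoment_smul, hz, gaussMoment_smul]
  ring

theorem gaussMoment_physHermitePoly (b : ℝ) (n : ℕ) :
    gaussMoment b (physHermitePoly n) = (2 * b) ^ n * gaussMoment b 1 := by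
  induction n with
  | zero => simp [physHermitePoly]
  | succ n ih => rw [physHermitePoly_succ, gaussMoment_raising, ih]; ring

theorem gaussMoment_physHermitePoly_mul (b : ℝ) (n : ℕ) (p : ℝ[X]) :
    gaussMoment b (physHermitePoly n * p) =
      gaussMoment b (((derivative + (2 * b) • 1 : Module.End ℝ ℝ[X]) ^ n) p) := by
  induction n generalizing p with
  | zero => simp [physHermitePoly]
  | succ n ih =>
    rw [pow_succ, Module.End.mul_apply, ← ih]
    have hs : physHermitePoly (n + 1) * p =
        (2 * X * (physHermitePoly n * p) - derivative (physHermitePoly n * p)) +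
          physHermitePoly n * derivative p := by
      rw [physHermitePoly_succ, derivative_mul]; ring
    have ht : physHermitePoly n * ((derivative + (2 * b) • 1 : Module.End ℝ ℝ[X]) p) =
        (2 * b) • (physHermitePoly n * p) + physHermitePoly n * derivative p := by
      simp [mul_add, add_comm]
    rw [hs, ht, gaussMoment_add, gaussMoment_add, gaussMoment_raising, gaussMoment_smul]

/-- The Laguerre-type polynomial `∑ m, (k choose m) x ^ m / m! = L_k (-x)`. -/
noncomputable def laguerreNeg (k : ℕ) : ℝ[X] :=
  ∑ m ∈ Finset.range (k + 1), monomial m ((k.choose m : ℝ) / m.factorial)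

theorem gaussMoment_physHermitePoly_sq (b : ℝ) (k : ℕ) :
    gaussMoment b (physHermitePoly k * physHermitePoly k) =
      2 ^ k * k.factorial * Real.sqrt Real.pi *
        (Real.exp (b ^ 2) * (laguerreNeg k).eval (2 * b ^ 2)) := by
  have hc : Commute ((2 * b) • 1 : Module.End ℝ ℝ[X]) derivative :=
    (Commute.one_left _).smul_left _
  rw [gaussMoment_physHermitePoly_mul, add_comm, hc.add_pow, LinearMap.sum_apply, gaussMoment_sum,
    laguerreNeg, eval_finsetSum, Finset.mul_sum, Finset.mul_sum]
  refine Finset.sum_congr rfl fun m hm => ?_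
  obtain ⟨j, rfl⟩ := Nat.exists_eq_add_of_le (Nat.lt_succ_iff.mp (Finset.mem_range.mp hm))
  have hmf : (m.factorial : ℝ) ≠ 0 := by positivity
  have happ : (((2 * b) • 1 : Module.End ℝ ℝ[X]) ^ m * derivative ^ (m + j - m) *
      ((m + j).choose m : Module.End ℝ ℝ[X]) : Module.End ℝ ℝ[X]) (physHermitePoly (m + j)) =
      ((m + j).choose m * (2 * b) ^ m * (2 ^ j * ((m + j).factorial / m.factorial)) : ℝ) •
        physHermitePoly m := by
    rw [Nat.add_sub_cancel_left, _root_.smul_pow, one_pow, smul_mul_assoc, one_mul, smul_mul_assoc,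
      LinearMap.smul_apply, Module.End.mul_apply, Module.End.natCast_apply, map_nsmul,
      Module.End.coe_pow, iterate_derivative_physHermitePoly, ← Nat.cast_smul_eq_nsmul ℝ,
      smul_smul, smul_smul]
    congr 1
    ring
  rw [happ, gaussMoment_smul, gaussMoment_physHermitePoly, gaussMoment_one, eval_monomial]
  field_simp
  ring

theorem hermiteFunR_sq (k : ℕ) (x : ℝ) :
    hermiteFunR k x ^ 2 = (2 ^ k * k.factorial * Real.sqrt Real.pi)⁻¹ *
      ((physHermitePoly k * physHermitePoly k).eval x * Real.exp (-x ^ 2)) := by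
  rw [hermiteFunR, physHermiteR_eq_eval, mul_pow, mul_pow, inv_pow,
    Real.sq_sqrt (by positivity), ← Real.exp_nat_mul, eval_mul]
  push_cast
  ring_nf

theorem exp_mul_hermiteFunR_sq (b : ℝ) (k : ℕ) (x : ℝ) :
    Real.exp (2 * b * x) * hermiteFunR k x ^ 2 = (2 ^ k * k.factorial * Real.sqrt Real.pi)⁻¹ *
      ((physHermitePoly k * physHermitePoly k).eval x * Real.exp (2 * b * x - x ^ 2)) := by
  rw [hermiteFunR_sq, sub_eq_add_neg, Real.exp_add]
  ring

theorem integrable_exp_mul_hermiteFunR_sq (b : ℝ) (k : ℕ) :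
    Integrable fun x : ℝ => Real.exp (2 * b * x) * hermiteFunR k x ^ 2 := by
  simp only [exp_mul_hermiteFunR_sq]
  exact (integrable_eval_mul_exp b _).const_mul _

theorem integral_exp_mul_hermiteFunR_sq (b : ℝ) (k : ℕ) :
    ∫ x : ℝ, Real.exp (2 * b * x) * hermiteFunR k x ^ 2 =
      Real.exp (b ^ 2) * (laguerreNeg k).eval (2 * b ^ 2) := by
  simp only [exp_mul_hermiteFunR_sq]
  rw [integral_const_mul, ← gaussMoment, gaussMoment_physHermitePoly_sq,
    inv_mul_cancel_left₀ (by positivity)]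

theorem coeff_laguerreNeg (k m : ℕ) :
    (laguerreNeg k).coeff m = (k.choose m : ℝ) / m.factorial := by
  simp only [laguerreNeg, finsetSum_coeff, coeff_monomial, Finset.sum_ite_eq', Finset.mem_range]
  split_ifs with h
  · rfl
  · rw [Nat.choose_eq_zero_of_lt (by omega)]; simp

/-- The Laguerre differential equation. -/
theorem laguerreNeg_ode (k : ℕ) :
    X * derivative (derivative (laguerreNeg k)) + (1 + X) * derivative (laguerreNeg k) =
      (k : ℝ) • laguerreNeg k := by
  have key : ∀ n : ℕ, (laguerreNeg k).coeff (n + 1) * (n + 1) ^ 2 =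
      (k - n) * (laguerreNeg k).coeff n := fun n => by
    have h : (k.choose (n + 1) : ℝ) * (n + 1) = k.choose n * (k - n) := by
      rcases le_or_gt n k with hn | hn
      · have := Nat.choose_succ_right_eq k n
        rw [← Nat.cast_sub hn]
        exact_mod_cast this
      · rw [Nat.choose_eq_zero_of_lt hn, Nat.choose_eq_zero_of_lt (by omega)]; simp
    have hf : (n.factorial : ℝ) ≠ 0 := by positivity
    rw [coeff_laguerreNeg, coeff_laguerreNeg, Nat.factorial_succ]
    push_cast
    field_simp
    linear_combination h
  ext n
  rw [add_mul, one_mul, coeff_add, coeff_add, coeff_smul, smul_eq_mul]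
  rcases n with _ | n
  · have := key 0
    simp only [coeff_X_mul_zero, coeff_derivative] at *
    push_cast at *
    linarith
  · have := key (n + 1)
    simp only [coeff_X_mul, coeff_derivative] at *
    push_cast at *
    linarith

end HermitePolynomial

/-- Sturm-type comparison for the radial equations with potentials `p` and `q`,
where `p ≤ q`. -/
theorem le_of_radial_ode_le {f f₁ p g g₁ q : ℝ → ℝ} {S : ℝ} (hS : 0 ≤ S)
    (hf : ∀ s, HasDerivAt f (f₁ s) s)
    (hf₁ : ∀ s, HasDerivAt (fun s => s * f₁ s) (s * (p s * f s)) s)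
    (hg : ∀ s, HasDerivAt g (g₁ s) s)
    (hg₁ : ∀ s, HasDerivAt (fun s => s * g₁ s) (s * (q s * g s)) s)
    (hpq : ∀ s ∈ Set.Icc 0 S, p s ≤ q s) (hfpos : ∀ s, 0 ≤ s → 0 < f s)
    (hgpos : ∀ s, 0 ≤ s → 0 < g s) (h0 : f 0 = g 0) : f S ≤ g S := by
  have hW : ∀ s, HasDerivAt (fun s => s * f₁ s * g s - f s * (s * g₁ s))
      (s * ((p s - q s) * (f s * g s))) s := fun s => by
    refine (((hf₁ s).mul (hg s)).sub ((hf s).mul (hg₁ s))).congr_deriv ?_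
    ring
  have hWanti : AntitoneOn (fun s => s * f₁ s * g s - f s * (s * g₁ s)) (Set.Icc 0 S) := by
    refine antitoneOn_of_deriv_nonpos (convex_Icc 0 S)
      (fun s _ => (hW s).continuousAt.continuousWithinAt)
      (fun s _ => (hW s).differentiableAt.differentiableWithinAt) fun s hs => ?_
    have hs' := interior_subset hs
    rw [(hW s).deriv]
    refine mul_nonpos_of_nonneg_of_nonpos hs'.1 (mul_nonpos_of_nonpos_of_nonneg ?_ ?_)
    · linarith [hpq s hs']
    · exact (mul_pos (hfpos s hs'.1) (hgpos s hs'.1)).le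
  have hdiv : ∀ s, 0 ≤ s → HasDerivAt (fun s => f s / g s)
      ((f₁ s * g s - f s * g₁ s) / g s ^ 2) s := fun s hs => (hf s).div (hg s) (hgpos s hs).ne'
  have hanti : AntitoneOn (fun s => f s / g s) (Set.Icc 0 S) := by
    refine antitoneOn_of_deriv_nonpos (convex_Icc 0 S)
      (fun s hs => (hdiv s hs.1).continuousAt.continuousWithinAt)
      (fun s hs => (hdiv s (interior_subset hs).1).differentiableAt.differentiableWithinAt)
      fun s hs => ?_
    rw [interior_Icc] at hs
    rw [(hdiv s hs.1.le).deriv]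
    refine div_nonpos_of_nonpos_of_nonneg ?_ (sq_nonneg _)
    have hle := hWanti ⟨le_rfl, hS⟩ ⟨hs.1.le, hs.2.le⟩ hs.1.le
    simp only [zero_mul, mul_zero, sub_zero] at hle
    refine nonpos_of_mul_nonpos_right (a := s) ?_ hs.1
    linarith
  have h := hanti ⟨le_rfl, hS⟩ ⟨hS, le_rfl⟩ hS
  have hg0 := (hgpos 0 le_rfl).ne'
  simp only [h0, div_self hg0] at h
  rwa [div_le_one (hgpos S hS)] at h

/-- The moments `∫₀^π cos ^ n θ exp (z cos θ) dθ`. -/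
noncomputable def cosExpMoment (n : ℕ) (z : ℝ) : ℝ :=
  ∫ θ in (0 : ℝ)..Real.pi, Real.cos θ ^ n * Real.exp (z * Real.cos θ)

theorem hasDerivAt_cosExpMoment (n : ℕ) (z : ℝ) :
    HasDerivAt (cosExpMoment n) (cosExpMoment (n + 1) z) z := by
  refine (intervalIntegral.hasDerivAt_integral_of_dominated_loc_of_deriv_le
    (F := fun z θ => Real.cos θ ^ n * Real.exp (z * Real.cos θ))
    (F' := fun z θ => Real.cos θ ^ (n + 1) * Real.exp (z * Real.cos θ))
    (bound := fun _ => Real.exp (|z| + 1)) (Metric.ball_mem_nhds z one_pos) ?_ ?_ ?_ ?_ ?_ ?_).2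
  · exact .of_forall fun x => Continuous.aestronglyMeasurable (by fun_prop)
  · exact Continuous.intervalIntegrable (by fun_prop) _ _
  · exact Continuous.aestronglyMeasurable (by fun_prop)
  · refine .of_forall fun θ _ x hx => ?_
    have hx' : |x| ≤ |z| + 1 := by
      have h1 := abs_sub_abs_le_abs_sub x z
      rw [Metric.mem_ball, Real.dist_eq] at hx
      linarith
    have hc := Real.abs_cos_le_one θ
    rw [norm_mul, Real.norm_eq_abs, Real.norm_eq_abs, Real.abs_exp, abs_pow]
    have hxc : x * Real.cos θ ≤ |z| + 1 := by
      refine (le_abs_self _).trans ?_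
      rw [abs_mul]
      nlinarith [abs_nonneg x]
    calc |Real.cos θ| ^ (n + 1) * Real.exp (x * Real.cos θ)
        ≤ 1 * Real.exp (|z| + 1) := by
          gcongr
          exact pow_le_one₀ (abs_nonneg _) hc
      _ = _ := one_mul _
  · exact intervalIntegrable_const
  · refine .of_forall fun θ _ x _ => ?_
    have h := ((hasDerivAt_id x).mul_const (Real.cos θ)).exp.const_mul (Real.cos θ ^ n)
    refine h.congr_deriv ?_
    simp only [id]
    ring

theorem cosExpMoment_one_eq (z : ℝ) :
    cosExpMoment 1 z + z * cosExpMoment 2 z = z * cosExpMoment 0 z := by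
  have hz : ∫ θ in (0 : ℝ)..Real.pi, (Real.cos θ * Real.exp (z * Real.cos θ) +
      Real.sin θ * (Real.exp (z * Real.cos θ) * (z * -Real.sin θ))) = 0 := by
    rw [intervalIntegral.integral_eq_sub_of_hasDerivAt
      (f := fun θ => Real.sin θ * Real.exp (z * Real.cos θ))
      (fun θ _ => (Real.hasDerivAt_sin θ).mul ((Real.hasDerivAt_cos θ).const_mul z).exp)
      (Continuous.intervalIntegrable (by fun_prop) _ _)]
    simp
  have hi : ∀ n : ℕ, IntervalIntegrable (fun θ => Real.cos θ ^ n * Real.exp (z * Real.cos θ))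
      volume 0 Real.pi := fun n => Continuous.intervalIntegrable (by fun_prop) _ _
  have hs : cosExpMoment 1 z + z * cosExpMoment 2 z - z * cosExpMoment 0 z = 0 := by
    rw [← hz, cosExpMoment, cosExpMoment, cosExpMoment, ← intervalIntegral.integral_const_mul,
      ← intervalIntegral.integral_const_mul, ← intervalIntegral.integral_add (hi 1)
      ((hi 2).const_mul z), ← intervalIntegral.integral_sub ((hi 1).add ((hi 2).const_mul z))
      ((hi 0).const_mul z)]
    refine intervalIntegral.integral_congr fun θ _ => ?_
    have := Real.sin_sq_add_cos_sq θ
    simp only [pow_one, pow_zero, one_mul]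
    linear_combination (z * Real.exp (z * Real.cos θ)) * this
  linarith

/-- The modified Bessel function `I₀` through its integral representation. -/
noncomputable def besselIZero (z : ℝ) : ℝ := Real.pi⁻¹ * cosExpMoment 0 z

theorem besselIZero_pos (z : ℝ) : 0 < besselIZero z := by
  refine mul_pos (inv_pos.mpr Real.pi_pos) ?_
  refine intervalIntegral.intervalIntegral_pos_of_pos
    (Continuous.intervalIntegrable (by fun_prop) _ _)
    (fun θ => ?_) Real.pi_pos
  positivity

theorem besselIZero_zero : besselIZero 0 = 1 := by
  simp [besselIZero, cosExpMoment, Real.pi_ne_zero]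

theorem hasDerivAt_besselIZero_mul (c s : ℝ) :
    HasDerivAt (fun s => besselIZero (c * s)) (Real.pi⁻¹ * (c * cosExpMoment 1 (c * s))) s := by
  have h := ((hasDerivAt_cosExpMoment 0 (c * s)).comp s
    ((hasDerivAt_id s).const_mul c)).const_mul Real.pi⁻¹
  refine h.congr_deriv ?_
  simp [mul_comm]

theorem hasDerivAt_mul_deriv_besselIZero_mul (c s : ℝ) :
    HasDerivAt (fun s => s * (Real.pi⁻¹ * (c * cosExpMoment 1 (c * s))))
      (s * (c ^ 2 * besselIZero (c * s))) s := by
  have h := (hasDerivAt_id s).mul ((((hasDerivAt_cosExpMoment 1 (c * s)).comp s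
    ((hasDerivAt_id s).const_mul c)).const_mul c).const_mul Real.pi⁻¹)
  refine h.congr_deriv ?_
  have h1 := cosExpMoment_one_eq (c * s)
  simp only [id, besselIZero, Function.comp]
  linear_combination (Real.pi⁻¹ * c) * h1

/-- `exp (s² / 2) L_k (-s²)`. -/
noncomputable def laguerreFun (k : ℕ) (s : ℝ) : ℝ :=
  Real.exp (s ^ 2 / 2) * (laguerreNeg k).eval (s ^ 2)

theorem laguerreNeg_eval_pos (k : ℕ) {x : ℝ} (hx : 0 ≤ x) : 0 < (laguerreNeg k).eval x := by
  simp only [laguerreNeg, Polynomial.eval_finsetSum, Polynomial.eval_monomial]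
  refine Finset.sum_pos' (fun m _ => by positivity) ⟨0, by simp, by simp⟩

theorem laguerreFun_zero (k : ℕ) : laguerreFun k 0 = 1 := by
  simp [laguerreFun, ← Polynomial.coeff_zero_eq_eval_zero, coeff_laguerreNeg]

theorem hasDerivAt_exp_sq_half_mul_eval (p : Polynomial ℝ) (s : ℝ) :
    HasDerivAt (fun s => Real.exp (s ^ 2 / 2) * p.eval (s ^ 2))
      (s * (Real.exp (s ^ 2 / 2) * (p + 2 * p.derivative).eval (s ^ 2))) s := by
  have h1 := ((hasDerivAt_pow 2 s).div_const 2).exp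
  have h2 := (p.hasDerivAt (s ^ 2)).comp s (hasDerivAt_pow 2 s)
  refine (h1.mul h2).congr_deriv ?_
  simp
  ring

theorem hasDerivAt_mul_deriv_laguerreFun (k : ℕ) (s : ℝ) :
    HasDerivAt (fun s => s * (s * (Real.exp (s ^ 2 / 2) *
        (laguerreNeg k + 2 * (laguerreNeg k).derivative).eval (s ^ 2))))
      (s * ((4 * k + 2 + s ^ 2) * laguerreFun k s)) s := by
  have h := (hasDerivAt_id s).mul ((hasDerivAt_id s).mul (hasDerivAt_exp_sq_half_mul_eval
    (laguerreNeg k + 2 * (laguerreNeg k).derivative) s))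
  refine h.congr_deriv ?_
  have hode := congrArg (Polynomial.eval (s ^ 2)) (laguerreNeg_ode k)
  simp only [Polynomial.eval_add, Polynomial.eval_mul, Polynomial.eval_X, Polynomial.eval_one,
    Polynomial.eval_smul, smul_eq_mul] at hode
  simp only [id, Pi.mul_apply, laguerreFun, Polynomial.derivative_add, Polynomial.derivative_mul,
    Polynomial.derivative_ofNat, Polynomial.eval_add, Polynomial.eval_mul, Polynomial.eval_ofNat,
    zero_mul, zero_add]
  linear_combination (4 * s * Real.exp (s ^ 2 / 2)) * hode

theorem besselIZero_le_laguerreFun (k : ℕ) {s : ℝ} (hs : 0 ≤ s) :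
    besselIZero (2 * Real.sqrt k * s) ≤ laguerreFun k s := by
  refine le_of_radial_ode_le (p := fun _ => (2 * Real.sqrt k) ^ 2)
    (q := fun s => 4 * k + 2 + s ^ 2) hs (hasDerivAt_besselIZero_mul _)
    (hasDerivAt_mul_deriv_besselIZero_mul _) (hasDerivAt_exp_sq_half_mul_eval _)
    (hasDerivAt_mul_deriv_laguerreFun k) (fun t _ => ?_) (fun _ _ => besselIZero_pos _)
    (fun t _ => mul_pos (Real.exp_pos _) (laguerreNeg_eval_pos k (sq_nonneg t))) ?_
  · rw [mul_pow, Real.sq_sqrt (Nat.cast_nonneg k)]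
    nlinarith [sq_nonneg t]
  · rw [mul_zero, besselIZero_zero]
    exact (laguerreFun_zero k).symm

theorem laguerreFun_le_besselIZero (k : ℕ) {s : ℝ} (hs : 0 ≤ s) :
    laguerreFun k s ≤ besselIZero (Real.sqrt (4 * k + 2 + s ^ 2) * s) := by
  refine le_of_radial_ode_le (p := fun s => 4 * k + 2 + s ^ 2)
    (q := fun _ => Real.sqrt (4 * k + 2 + s ^ 2) ^ 2) hs
    (hasDerivAt_exp_sq_half_mul_eval _) (hasDerivAt_mul_deriv_laguerreFun k)
    (hasDerivAt_besselIZero_mul _) (hasDerivAt_mul_deriv_besselIZero_mul _) (fun t ht => ?_)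
    (fun t _ => mul_pos (Real.exp_pos _) (laguerreNeg_eval_pos k (sq_nonneg t)))
    (fun _ _ => besselIZero_pos _) ?_
  · rw [Real.sq_sqrt (by positivity)]
    have := pow_le_pow_left₀ ht.1 ht.2 2
    linarith
  · rw [mul_zero, besselIZero_zero]
    exact laguerreFun_zero k

theorem cos_le_one_sub_sq_add_pow_four (θ : ℝ) :
    Real.cos θ ≤ 1 - θ ^ 2 / 2 + θ ^ 4 / 2 := by
  rcases le_total |θ| 1 with h | h
  · have h1 := (abs_le.mp (Real.cos_bound h)).2
    have h2 : |θ| ^ 4 = θ ^ 4 := (even_two_mul 2).pow_abs θ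
    nlinarith [sq_nonneg (θ ^ 2)]
  · have h1 : 1 ≤ θ ^ 2 := by rw [← sq_abs]; nlinarith
    nlinarith [Real.cos_le_one θ]

theorem exp_neg_sub_exp_neg_le (A B : ℝ) :
    Real.exp (-A) - Real.exp (-B) ≤ (B - A) * Real.exp (-A) := by
  have h := Real.add_one_le_exp (A - B)
  have h2 : Real.exp (-B) = Real.exp (A - B) * Real.exp (-A) := by
    rw [← Real.exp_add]; ring_nf
  rw [h2]
  nlinarith [Real.exp_pos (-A)]

theorem integrableOn_pow_mul_exp_neg_mul_sq {b : ℝ} (hb : 0 < b) (n : ℕ) :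
    IntegrableOn (fun θ : ℝ => θ ^ n * Real.exp (-b * θ ^ 2)) (Set.Ioi 0) := by
  have h := integrable_rpow_mul_exp_neg_mul_sq hb (s := n)
    (by linarith [Nat.cast_nonneg (α := ℝ) n])
  simpa only [Real.rpow_natCast] using h.integrableOn

theorem integral_pow_mul_exp_neg_mul_sq {b : ℝ} (hb : 0 < b) (n : ℕ) :
    ∫ θ in Set.Ioi (0 : ℝ), θ ^ n * Real.exp (-b * θ ^ 2) =
      b ^ (-((n : ℝ) + 1) / 2) * (1 / 2) * Real.Gamma (((n : ℝ) + 1) / 2) := by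
  rw [← integral_rpow_mul_exp_neg_mul_rpow two_pos
    (by linarith [Nat.cast_nonneg (α := ℝ) n] : (-1 : ℝ) < n) hb]
  simp

/-- Laplace's method for `∫₀^π exp (-z (1 - cos θ)) dθ`, with error term. -/
theorem exists_abs_integral_exp_neg_one_sub_cos_le :
    ∃ C : ℝ, 0 < C ∧ ∀ z : ℝ, 0 < z →
      |(∫ θ in (0 : ℝ)..Real.pi, Real.exp (-(z * (1 - Real.cos θ)))) -
        Real.sqrt (Real.pi / (z / 2)) / 2| ≤ C * z ^ (-(3 : ℝ) / 2) := by
  set κ : ℝ := 2 / Real.pi ^ 2 with hκ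
  have hκ0 : 0 < κ := by positivity
  have hκ1 : κ ≤ 1 / 2 := by
    rw [hκ, div_le_div_iff₀ (by positivity) two_pos]
    nlinarith [Real.pi_gt_three]
  have hG5 : 0 < Real.Gamma (5 / 2) := Real.Gamma_pos_of_pos (by norm_num)
  have hG3 : 0 < Real.Gamma (3 / 2) := Real.Gamma_pos_of_pos (by norm_num)
  refine ⟨1 / 2 * (κ ^ (-(5 : ℝ) / 2) * (1 / 2) * Real.Gamma (5 / 2)) +
    κ ^ (-(3 : ℝ) / 2) * (1 / 2) * Real.Gamma (3 / 2), by positivity, fun z hz => ?_⟩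
  have hκz : 0 < κ * z := by positivity
  have hF : ∫ θ in (0 : ℝ)..Real.pi, Real.exp (-(z * (1 - Real.cos θ))) =
      ∫ θ in Set.Ioi (0 : ℝ), (Set.Iic Real.pi).indicator
        (fun θ => Real.exp (-(z * (1 - Real.cos θ)))) θ := by
    rw [intervalIntegral.integral_of_le Real.pi_pos.le, setIntegral_indicator measurableSet_Iic,
      Set.Ioi_inter_Iic]
  have hFi : IntegrableOn ((Set.Iic Real.pi).indicator
      (fun θ => Real.exp (-(z * (1 - Real.cos θ))))) (Set.Ioi (0 : ℝ)) := by
    rw [IntegrableOn, integrable_indicator_iff measurableSet_Iic, IntegrableOn,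
      Measure.restrict_restrict measurableSet_Iic, Set.inter_comm, Set.Ioi_inter_Iic]
    have hcont : Continuous fun θ : ℝ => Real.exp (-(z * (1 - Real.cos θ))) := by fun_prop
    exact hcont.integrableOn_Icc.mono_set Set.Ioc_subset_Icc_self
  have hgi := integrableOn_pow_mul_exp_neg_mul_sq (half_pos hz) 0
  simp only [pow_zero, one_mul] at hgi
  have hbi : IntegrableOn (fun θ : ℝ => z / 2 * (θ ^ 4 * Real.exp (-(κ * z) * θ ^ 2)) +
      θ ^ 2 * Real.exp (-(κ * z) * θ ^ 2)) (Set.Ioi 0) :=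
    ((integrableOn_pow_mul_exp_neg_mul_sq hκz 4).const_mul _).add
      (integrableOn_pow_mul_exp_neg_mul_sq hκz 2)
  rw [hF, ← integral_gaussian_Ioi, ← integral_sub hFi hgi]
  rw [← Real.norm_eq_abs]
  refine (norm_integral_le_of_norm_le hbi ?_).trans (le_of_eq ?_)
  · refine (ae_restrict_mem measurableSet_Ioi).mono fun θ hθ => ?_
    have hθ0 : 0 < θ := hθ
    have hB : Real.exp (-(z / 2) * θ ^ 2) ≤ Real.exp (-(κ * z) * θ ^ 2) := by
      refine Real.exp_le_exp.mpr ?_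
      nlinarith [mul_nonneg (mul_nonneg hz.le (sq_nonneg θ)) (sub_nonneg.mpr hκ1)]
    rw [Real.norm_eq_abs]
    by_cases hπ : θ ≤ Real.pi
    · rw [Set.indicator_of_mem (Set.mem_Iic.mpr hπ)]
      have hc1 := Real.one_sub_sq_div_two_le_cos (x := θ)
      have hc2 := Real.cos_le_one_sub_mul_cos_sq (x := θ) (by rwa [abs_of_pos hθ0])
      have hc3 := cos_le_one_sub_sq_add_pow_four θ
      have hnn : Real.exp (-(z / 2) * θ ^ 2) ≤ Real.exp (-(z * (1 - Real.cos θ))) :=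
        Real.exp_le_exp.mpr (by nlinarith)
      have hA : Real.exp (-(z * (1 - Real.cos θ))) ≤ Real.exp (-(κ * z) * θ ^ 2) :=
        Real.exp_le_exp.mpr (by rw [← hκ] at hc2; nlinarith)
      rw [abs_of_nonneg (sub_nonneg.mpr hnn)]
      have h := exp_neg_sub_exp_neg_le (z * (1 - Real.cos θ)) (z / 2 * θ ^ 2)
      rw [← neg_mul (z / 2)] at h
      have h2 : z / 2 * θ ^ 2 - z * (1 - Real.cos θ) ≤ z / 2 * θ ^ 4 := by nlinarith
      have h3 : (z / 2 * θ ^ 2 - z * (1 - Real.cos θ)) * Real.exp (-(z * (1 - Real.cos θ))) ≤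
          z / 2 * θ ^ 4 * Real.exp (-(κ * z) * θ ^ 2) :=
        mul_le_mul h2 hA (Real.exp_pos _).le (by positivity)
      have h4 : 0 ≤ θ ^ 2 * Real.exp (-(κ * z) * θ ^ 2) := by positivity
      linarith
    · rw [Set.indicator_of_notMem (by simpa using hπ), zero_sub, abs_neg, Real.abs_exp]
      have h1 : 1 ≤ θ ^ 2 := by nlinarith [Real.pi_gt_three]
      have h4 : 0 ≤ z / 2 * (θ ^ 4 * Real.exp (-(κ * z) * θ ^ 2)) := by positivity
      nlinarith [Real.exp_pos (-(κ * z) * θ ^ 2)]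
  · rw [integral_add ((integrableOn_pow_mul_exp_neg_mul_sq hκz 4).const_mul _)
      (integrableOn_pow_mul_exp_neg_mul_sq hκz 2), integral_const_mul,
      integral_pow_mul_exp_neg_mul_sq hκz, integral_pow_mul_exp_neg_mul_sq hκz,
      Real.mul_rpow hκ0.le hz.le, Real.mul_rpow hκ0.le hz.le]
    have hz5 : z * z ^ (-(5 : ℝ) / 2) = z ^ (-(3 : ℝ) / 2) := by
      rw [← Real.rpow_one_add' hz.le (by norm_num)]
      norm_num
    rw [show ((4 : ℕ) : ℝ) + 1 = 5 by norm_num, show ((2 : ℕ) : ℝ) + 1 = 3 by norm_num]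
    linear_combination (1 / 2 * (κ ^ (-(5 : ℝ) / 2) * (1 / 2) * Real.Gamma (5 / 2))) * hz5

theorem exists_abs_besselIZero_sub_one_le :
    ∃ C : ℝ, 0 < C ∧ ∀ z : ℝ, 0 < z →
      |Real.sqrt (2 * Real.pi * z) * Real.exp (-z) * besselIZero z - 1| ≤ C / z := by
  obtain ⟨C, hC, h⟩ := exists_abs_integral_exp_neg_one_sub_cos_le
  refine ⟨Real.sqrt (2 * Real.pi) / Real.pi * C, by positivity, fun z hz => ?_⟩
  have hint : Real.exp (-z) * cosExpMoment 0 z =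
      ∫ θ in (0 : ℝ)..Real.pi, Real.exp (-(z * (1 - Real.cos θ))) := by
    rw [cosExpMoment, ← intervalIntegral.integral_const_mul]
    refine intervalIntegral.integral_congr fun θ _ => ?_
    simp only [pow_zero, one_mul]
    rw [← Real.exp_add]
    ring_nf
  have hone : Real.sqrt (2 * Real.pi * z) / Real.pi * (Real.sqrt (Real.pi / (z / 2)) / 2) = 1 := by
    have hmul : Real.sqrt (2 * Real.pi * z) * Real.sqrt (Real.pi / (z / 2)) = 2 * Real.pi := by
      rw [← Real.sqrt_mul (by positivity), show 2 * Real.pi * z * (Real.pi / (z / 2)) =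
        (2 * Real.pi) ^ 2 by field_simp, Real.sqrt_sq (by positivity)]
    rw [div_mul_div_comm, hmul]
    field_simp
  have heq : Real.sqrt (2 * Real.pi * z) * Real.exp (-z) * besselIZero z - 1 =
      Real.sqrt (2 * Real.pi * z) / Real.pi *
        ((∫ θ in (0 : ℝ)..Real.pi, Real.exp (-(z * (1 - Real.cos θ)))) -
          Real.sqrt (Real.pi / (z / 2)) / 2) := by
    rw [mul_sub, hone, ← hint, besselIZero]
    ring
  have hz32 : Real.sqrt z * z ^ (-(3 : ℝ) / 2) = z⁻¹ := by
    rw [Real.sqrt_eq_rpow, ← Real.rpow_add hz, ← Real.rpow_neg_one]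
    norm_num
  rw [heq, abs_mul, abs_of_nonneg (by positivity)]
  calc _ ≤ Real.sqrt (2 * Real.pi * z) / Real.pi * (C * z ^ (-(3 : ℝ) / 2)) := by
        gcongr
        exact h z hz
    _ = _ := by
        rw [Real.sqrt_mul (by positivity) z, div_eq_mul_inv _ z, ← hz32]
        ring

theorem integral_exp_mul_hermiteFunR_sq_eq_laguerreFun {a b : ℝ} (hb : b ^ 2 = a ^ 2) (k : ℕ) :
    ∫ x : ℝ, Real.exp (2 * b * x) * hermiteFunR k x ^ 2 = laguerreFun k (Real.sqrt 2 * a) := by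
  rw [integral_exp_mul_hermiteFunR_sq, laguerreFun, mul_pow, Real.sq_sqrt two_pos.le, hb,
    mul_div_cancel_left₀ _ two_ne_zero]

theorem integral_hermiteFunR_sq (k : ℕ) : ∫ x : ℝ, hermiteFunR k x ^ 2 = 1 := by
  have h := integral_exp_mul_hermiteFunR_sq_eq_laguerreFun (a := 0) (b := 0) rfl k
  simpa [laguerreFun_zero] using h

theorem integrable_hermiteFunR_sq (k : ℕ) : Integrable fun x : ℝ => hermiteFunR k x ^ 2 := by
  simpa using integrable_exp_mul_hermiteFunR_sq 0 k

theorem exp_sqrt_one_add_sq_lower {a : ℝ} (ha : 0 < a) (x : ℝ) :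
    Real.exp (2 * a * x) + Real.exp (2 * -a * x) - 1 ≤
      Real.exp (2 * a * Real.sqrt (1 + x ^ 2)) := by
  have h : |x| ≤ Real.sqrt (1 + x ^ 2) := Real.abs_le_sqrt (by linarith)
  have h1 : Real.exp (2 * a * |x|) ≤ Real.exp (2 * a * Real.sqrt (1 + x ^ 2)) := by gcongr
  rcases le_total 0 x with hx | hx
  · rw [abs_of_nonneg hx] at h1
    have : Real.exp (2 * -a * x) ≤ 1 := Real.exp_le_one_iff.mpr (by nlinarith)
    linarith
  · rw [abs_of_nonpos hx, show 2 * a * -x = 2 * -a * x by ring] at h1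
    have : Real.exp (2 * a * x) ≤ 1 := Real.exp_le_one_iff.mpr (by nlinarith)
    linarith

theorem exp_sqrt_one_add_sq_upper {a t : ℝ} (ha : 0 < a) (ht : 0 < t) (x : ℝ) :
    Real.exp (2 * a * Real.sqrt (1 + x ^ 2)) ≤
      Real.exp (a / t) * (Real.exp (2 * a * x) + Real.exp (2 * -a * x)) +
        Real.exp (2 * a * Real.sqrt (1 + t ^ 2)) := by
  rcases le_total |x| t with hx | hx
  · have h1 : x ^ 2 ≤ t ^ 2 := sq_le_sq' (abs_le.mp hx).1 (abs_le.mp hx).2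
    have h2 : Real.exp (2 * a * Real.sqrt (1 + x ^ 2)) ≤
        Real.exp (2 * a * Real.sqrt (1 + t ^ 2)) := by gcongr
    have h3 : 0 ≤ Real.exp (a / t) * (Real.exp (2 * a * x) + Real.exp (2 * -a * x)) := by positivity
    linarith
  · have hsq : Real.sqrt (1 + x ^ 2) ≤ |x| + 1 / (2 * t) := by
      refine Real.sqrt_le_iff.mpr ⟨by positivity, ?_⟩
      have h1 : 1 ≤ |x| / t := (one_le_div ht).mpr hx
      have h2 : (|x| + 1 / (2 * t)) ^ 2 = x ^ 2 + |x| / t + (1 / (2 * t)) ^ 2 := by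
        rw [← sq_abs x]; field_simp; ring
      rw [h2]
      nlinarith [sq_nonneg (1 / (2 * t))]
    have h2 : Real.exp (2 * a * Real.sqrt (1 + x ^ 2)) ≤
        Real.exp (a / t) * Real.exp (2 * a * |x|) := by
      rw [← Real.exp_add]
      refine Real.exp_le_exp.mpr ?_
      calc 2 * a * Real.sqrt (1 + x ^ 2) ≤ 2 * a * (|x| + 1 / (2 * t)) := by gcongr
        _ = a / t + 2 * a * |x| := by field_simp; ring
    have h3 : Real.exp (2 * a * |x|) ≤ Real.exp (2 * a * x) + Real.exp (2 * -a * x) := by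
      rcases abs_cases x with ⟨h, -⟩ | ⟨h, -⟩ <;> rw [h]
      · linarith [Real.exp_pos (2 * -a * x)]
      · rw [show 2 * a * -x = 2 * -a * x by ring]
        linarith [Real.exp_pos (2 * a * x)]
    have h4 := mul_le_mul_of_nonneg_left h3 (Real.exp_pos (a / t)).le
    linarith [Real.exp_pos (2 * a * Real.sqrt (1 + t ^ 2))]

theorem integral_exp_sqrt_mul_hermiteFunR_sq_bounds {a t : ℝ} (ha : 0 < a) (ht : 0 < t) (k : ℕ) :
    2 * laguerreFun k (Real.sqrt 2 * a) - 1 ≤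
        ∫ x : ℝ, Real.exp (2 * a * Real.sqrt (1 + x ^ 2)) * hermiteFunR k x ^ 2 ∧
      ∫ x : ℝ, Real.exp (2 * a * Real.sqrt (1 + x ^ 2)) * hermiteFunR k x ^ 2 ≤
        Real.exp (a / t) * (2 * laguerreFun k (Real.sqrt 2 * a)) +
          Real.exp (2 * a * Real.sqrt (1 + t ^ 2)) := by
  have hi := (integrable_exp_mul_hermiteFunR_sq a k).add (integrable_exp_mul_hermiteFunR_sq (-a) k)
  have h2 : ∫ x : ℝ, (Real.exp (2 * a * x) * hermiteFunR k x ^ 2 +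
      Real.exp (2 * -a * x) * hermiteFunR k x ^ 2) = 2 * laguerreFun k (Real.sqrt 2 * a) := by
    rw [integral_add (integrable_exp_mul_hermiteFunR_sq a k)
      (integrable_exp_mul_hermiteFunR_sq (-a) k),
      integral_exp_mul_hermiteFunR_sq_eq_laguerreFun (a := a) rfl,
      integral_exp_mul_hermiteFunR_sq_eq_laguerreFun (a := a) (neg_sq a)]
    ring
  have h0 := integrable_hermiteFunR_sq k
  have hub := (hi.const_mul (Real.exp (a / t))).add
    (h0.const_mul (Real.exp (2 * a * Real.sqrt (1 + t ^ 2))))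
  have hle : ∀ x : ℝ, Real.exp (2 * a * Real.sqrt (1 + x ^ 2)) * hermiteFunR k x ^ 2 ≤
      Real.exp (a / t) * (Real.exp (2 * a * x) * hermiteFunR k x ^ 2 +
        Real.exp (2 * -a * x) * hermiteFunR k x ^ 2) +
      Real.exp (2 * a * Real.sqrt (1 + t ^ 2)) * hermiteFunR k x ^ 2 := fun x => by
    have h := mul_le_mul_of_nonneg_right (exp_sqrt_one_add_sq_upper ha ht x)
      (sq_nonneg (hermiteFunR k x))
    linarith
  have hint : Integrable fun x : ℝ =>
      Real.exp (2 * a * Real.sqrt (1 + x ^ 2)) * hermiteFunR k x ^ 2 := by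
    refine hub.mono' ?_ (.of_forall fun x => ?_)
    · exact Continuous.aestronglyMeasurable (by fun_prop) |>.mul h0.aestronglyMeasurable
    · rw [Real.norm_eq_abs, abs_of_nonneg (by positivity)]
      exact hle x
  constructor
  · refine le_trans (le_of_eq ?_) (integral_mono (hi.sub h0) hint fun x => ?_)
    · exact ((integral_sub hi h0).trans (congrArg₂ _ h2 (integral_hermiteFunR_sq k))).symm
    have h := mul_le_mul_of_nonneg_right (exp_sqrt_one_add_sq_lower ha x)
      (sq_nonneg (hermiteFunR k x))
    simp only [Pi.add_apply, Pi.sub_apply]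
    linarith
  · refine (integral_mono hint hub hle).trans (le_of_eq ?_)
    refine (integral_add (hi.const_mul _) (h0.const_mul _)).trans ?_
    rw [integral_const_mul, integral_const_mul, integral_hermiteFunR_sq, mul_one]
    exact congrArg (fun y => Real.exp (a / t) * y + _) h2

/-- Two-sided asymptotics of `laguerreFun` for a large index, normalised by the leading behaviour
of `besselIZero (2 √k s)`. -/
theorem exists_laguerreFun_asymptotics {s : ℝ} (hs : 0 < s) :
    ∃ N : ℝ, 0 < N ∧ ∀ k : ℕ, 1 ≤ k →
      1 - N / Real.sqrt k ≤ Real.sqrt (2 * Real.pi * (2 * Real.sqrt k * s)) *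
          Real.exp (-(2 * Real.sqrt k * s)) * laguerreFun k s ∧
        Real.sqrt (2 * Real.pi * (2 * Real.sqrt k * s)) * Real.exp (-(2 * Real.sqrt k * s)) *
          laguerreFun k s ≤
            Real.exp ((2 + s ^ 2) * s / 4 / Real.sqrt k) * (1 + N / Real.sqrt k) := by
  obtain ⟨C, hC, h⟩ := exists_abs_besselIZero_sub_one_le
  refine ⟨C / (2 * s), by positivity, fun k hk => ?_⟩
  have hk0 : (0 : ℝ) < k := by exact_mod_cast hk
  set t := Real.sqrt k with ht
  have ht0 : 0 < t := Real.sqrt_pos.mpr hk0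
  have ht2 : t ^ 2 = k := Real.sq_sqrt hk0.le
  set z₀ := 2 * t * s with hz₀
  set z₂ := Real.sqrt (4 * k + 2 + s ^ 2) * s with hz₂
  have hz₀pos : 0 < z₀ := by positivity
  have hN : C / (2 * s) / t = C / z₀ := by rw [div_div, hz₀]; ring_nf
  have hz : z₀ ≤ z₂ := by
    refine mul_le_mul_of_nonneg_right (Real.le_sqrt_of_sq_le ?_) hs.le
    nlinarith [sq_nonneg s]
  have hz' : z₂ - z₀ ≤ (2 + s ^ 2) * s / 4 / t := by
    have h1 : Real.sqrt (4 * k + 2 + s ^ 2) ≤ 2 * t + (2 + s ^ 2) / 4 / t := by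
      refine Real.sqrt_le_iff.mpr ⟨by positivity, ?_⟩
      have h2 : (2 * t + (2 + s ^ 2) / 4 / t) ^ 2 =
          4 * t ^ 2 + (2 + s ^ 2) + ((2 + s ^ 2) / 4 / t) ^ 2 := by field_simp; ring
      rw [h2, ht2]
      nlinarith [sq_nonneg ((2 + s ^ 2) / 4 / t)]
    have h3 := mul_le_mul_of_nonneg_right h1 hs.le
    have h4 : (2 * t + (2 + s ^ 2) / 4 / t) * s = z₀ + (2 + s ^ 2) * s / 4 / t := by
      rw [hz₀]; ring
    linarith
  rw [hN]
  constructor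
  · have h1 := (abs_le.mp (h z₀ hz₀pos)).1
    have h2 : Real.sqrt (2 * Real.pi * z₀) * Real.exp (-z₀) * besselIZero z₀ ≤
        Real.sqrt (2 * Real.pi * z₀) * Real.exp (-z₀) * laguerreFun k s := by
      gcongr
      exact besselIZero_le_laguerreFun k hs.le
    linarith
  · have h1 := (abs_le.mp (h z₂ (hz₀pos.trans_le hz))).2
    have h2 : C / z₂ ≤ C / z₀ := by gcongr
    have hpos := (besselIZero_pos z₂).le
    calc Real.sqrt (2 * Real.pi * z₀) * Real.exp (-z₀) * laguerreFun k s
        ≤ Real.sqrt (2 * Real.pi * z₂) * Real.exp (-z₀) * besselIZero z₂ := by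
          refine mul_le_mul ?_ (laguerreFun_le_besselIZero k hs.le) ?_ (by positivity)
          · gcongr
          · exact mul_nonneg (Real.exp_pos _).le (laguerreNeg_eval_pos k (sq_nonneg s)).le
      _ = Real.exp (z₂ - z₀) *
          (Real.sqrt (2 * Real.pi * z₂) * Real.exp (-z₂) * besselIZero z₂) := by
          rw [show -z₀ = (z₂ - z₀) + -z₂ by ring, Real.exp_add]
          ring
      _ ≤ Real.exp ((2 + s ^ 2) * s / 4 / t) * (1 + C / z₀) := by
          gcongr
          linarith

theorem two_mul_prefactor (a : ℝ) (k : ℕ) :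
    2 * ((2 * (k : ℝ)) ^ ((1 : ℝ) / 4) * Real.sqrt (a * Real.pi) *
        Real.exp (-(2 ^ ((3 : ℝ) / 2) * a * Real.sqrt k))) =
      Real.sqrt (2 * Real.pi * (2 * Real.sqrt k * (Real.sqrt 2 * a))) *
        Real.exp (-(2 * Real.sqrt k * (Real.sqrt 2 * a))) := by
  have h1 : (2 : ℝ) ^ ((3 : ℝ) / 2) = 2 * Real.sqrt 2 := by
    rw [Real.sqrt_eq_rpow, ← Real.rpow_one_add' two_pos.le (by norm_num)]
    norm_num
  have h2 : (2 * (k : ℝ)) ^ ((1 : ℝ) / 4) = Real.sqrt (Real.sqrt (2 * k)) := by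
    rw [Real.sqrt_eq_rpow, Real.sqrt_eq_rpow, ← Real.rpow_mul (by positivity)]
    norm_num
  have h3 : 2 * Real.pi * (2 * Real.sqrt k * (Real.sqrt 2 * a)) =
      2 ^ 2 * (Real.sqrt (2 * k) * (a * Real.pi)) := by
    rw [Real.sqrt_mul two_pos.le]; ring
  rw [h1, h2, h3, Real.sqrt_mul (sq_nonneg 2) (Real.sqrt (2 * k) * _), Real.sqrt_sq two_pos.le,
    Real.sqrt_mul (Real.sqrt_nonneg _)]
  ring_nf

theorem mul_exp_neg_mul_le {δ t : ℝ} (hδ : 0 < δ) (ht : 0 < t) :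
    t * Real.exp (-(δ * t)) ≤ 2 / δ ^ 2 / t := by
  have h := Real.quadratic_le_exp_of_nonneg (mul_pos hδ ht).le
  have h1 : (δ * t) ^ 2 / 2 ≤ Real.exp (δ * t) := by linarith [mul_pos hδ ht]
  rw [Real.exp_neg, ← div_eq_mul_inv, div_div, div_le_div_iff₀ (Real.exp_pos _) (by positivity)]
  linarith

theorem prefactor_mul_exp_le {a t : ℝ} (ha : 0 < a) (ht : 1 ≤ t) :
    Real.sqrt (2 * Real.pi * (2 * t * (Real.sqrt 2 * a))) *
        Real.exp (-(2 * t * (Real.sqrt 2 * a))) * Real.exp (2 * a * Real.sqrt (1 + t ^ 2)) ≤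
      Real.sqrt (4 * Real.pi * (Real.sqrt 2 * a)) * Real.exp (2 * a) *
        (2 / (2 * a * (Real.sqrt 2 - 1)) ^ 2) / t := by
  have ht0 : 0 < t := one_pos.trans_le ht
  have h2 : 1 < Real.sqrt 2 := Real.lt_sqrt_of_sq_lt (by norm_num)
  have hδ : 0 < 2 * a * (Real.sqrt 2 - 1) := mul_pos (by positivity) (by linarith)
  have hs : Real.sqrt (1 + t ^ 2) ≤ 1 + t := Real.sqrt_le_iff.mpr ⟨by positivity, by nlinarith⟩
  have h3 : Real.sqrt (2 * Real.pi * (2 * t * (Real.sqrt 2 * a))) ≤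
      Real.sqrt (4 * Real.pi * (Real.sqrt 2 * a)) * t := by
    rw [show 2 * Real.pi * (2 * t * (Real.sqrt 2 * a)) = 4 * Real.pi * (Real.sqrt 2 * a) * t by ring,
      Real.sqrt_mul (by positivity)]
    gcongr
    exact Real.sqrt_le_iff.mpr ⟨ht0.le, by nlinarith⟩
  calc _ ≤ Real.sqrt (4 * Real.pi * (Real.sqrt 2 * a)) * t *
        Real.exp (-(2 * t * (Real.sqrt 2 * a))) * Real.exp (2 * a * (1 + t)) := by gcongr
    _ = Real.sqrt (4 * Real.pi * (Real.sqrt 2 * a)) * Real.exp (2 * a) *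
        (t * Real.exp (-(2 * a * (Real.sqrt 2 - 1) * t))) := by
        have h : Real.exp (-(2 * t * (Real.sqrt 2 * a))) * Real.exp (2 * a * (1 + t)) =
            Real.exp (2 * a) * Real.exp (-(2 * a * (Real.sqrt 2 - 1) * t)) := by
          rw [← Real.exp_add, ← Real.exp_add]; ring_nf
        rw [mul_assoc, h]
        ring
    _ ≤ Real.sqrt (4 * Real.pi * (Real.sqrt 2 * a)) * Real.exp (2 * a) *
        (2 / (2 * a * (Real.sqrt 2 - 1)) ^ 2 / t) := by
        gcongr
        exact mul_exp_neg_mul_le hδ ht0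
    _ = _ := by ring

theorem exp_div_le_one_add {d t : ℝ} (hd : 0 ≤ d) (ht : 1 ≤ t) :
    Real.exp (d / t) ≤ 1 + d * Real.exp d / t := by
  have ht0 : 0 < t := one_pos.trans_le ht
  have h1 := exp_neg_sub_exp_neg_le (-(d / t)) 0
  rw [neg_neg, neg_zero, Real.exp_zero, zero_sub, neg_neg] at h1
  have h2 : d / t * Real.exp (d / t) ≤ d / t * Real.exp d := by
    gcongr
    exact div_le_self hd ht
  have h3 : d / t * Real.exp d = d * Real.exp d / t := by ring
  linarith

/-- Asymptotics for `‖f_k‖²` where `f_k = e^p h_k` and `p(x) = a√(1+x²)`: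
`∫ e^{2a√(1+x²)} h_k² = ((2k)^{1/4}√(aπ))^{−1} exp(2^{3/2}a√k) (1 + O(k^{−1/2}))`. -/
theorem stmt_18 (a : ℝ) (ha : 0 < a) :
    ∃ C : ℝ, 0 < C ∧ ∃ K : ℕ, ∀ k : ℕ, K ≤ k →
      |(2 * (k : ℝ)) ^ ((1 : ℝ) / 4) * Real.sqrt (a * Real.pi) *
          Real.exp (-(2 ^ ((3 : ℝ) / 2) * a * Real.sqrt k)) *
          (∫ x : ℝ, Real.exp (2 * a * Real.sqrt (1 + x ^ 2)) * hermiteFunR k x ^ 2) - 1|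
        ≤ C * (k : ℝ) ^ (-(1 : ℝ) / 2) := by
  set s := Real.sqrt 2 * a with hs
  have hs0 : 0 < s := by positivity
  obtain ⟨N, hN, hL⟩ := exists_laguerreFun_asymptotics hs0
  set d := a + (2 + s ^ 2) * s / 4 with hd
  have hd0 : 0 < d := by positivity
  set M := d * Real.exp d with hM
  have hM0 : 0 < M := by positivity
  have h2 : 1 < Real.sqrt 2 := Real.lt_sqrt_of_sq_lt (by norm_num)
  set R := Real.sqrt (4 * Real.pi * s) * Real.exp (2 * a) *
    (2 / (2 * a * (Real.sqrt 2 - 1)) ^ 2) with hR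
  have hR0 : 0 ≤ R := by positivity
  refine ⟨M + N + M * N + R, by positivity, 1, fun k hk => ?_⟩
  have hk1 : (1 : ℝ) ≤ k := by exact_mod_cast hk
  obtain ⟨hlow, hupp⟩ := hL k hk
  have hpre := two_mul_prefactor a k
  have hrpow : (k : ℝ) ^ (-(1 : ℝ) / 2) = (Real.sqrt k)⁻¹ := by
    rw [Real.sqrt_eq_rpow, ← Real.rpow_neg (Nat.cast_nonneg k)]
    norm_num
  set t := Real.sqrt k with ht
  have ht1 : 1 ≤ t := Real.one_le_sqrt.mpr hk1
  have ht0 : 0 < t := one_pos.trans_le ht1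
  have htail := prefactor_mul_exp_le ha ht1
  obtain ⟨hIlow, hIupp⟩ := integral_exp_sqrt_mul_hermiteFunR_sq_bounds ha ht0 k
  set A := (2 * (k : ℝ)) ^ ((1 : ℝ) / 4) * Real.sqrt (a * Real.pi) *
    Real.exp (-(2 ^ ((3 : ℝ) / 2) * a * t)) with hA
  have hA0 : 0 ≤ A := by positivity
  rw [← hs] at hpre htail hIlow hIupp
  rw [← hpre] at hlow hupp htail
  rw [← hR] at htail
  have hE1 : 1 ≤ Real.exp (2 * a * Real.sqrt (1 + t ^ 2)) := Real.one_le_exp (by positivity)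
  have hRt : 0 ≤ R / t := by positivity
  have hAR : A ≤ R / t := by nlinarith
  have hsum : (M + N + M * N + R) * t⁻¹ = M / t + N / t + M * N / t + R / t := by ring
  rw [hrpow, hsum, abs_le]
  have hMt : 0 ≤ M / t := by positivity
  have hMNt : 0 ≤ M * N / t := by positivity
  constructor
  · have h := mul_le_mul_of_nonneg_left hIlow hA0
    linarith
  · have h := mul_le_mul_of_nonneg_left hIupp hA0
    have hexp : Real.exp (a / t) * Real.exp ((2 + s ^ 2) * s / 4 / t) ≤ 1 + M / t := by
      rw [← Real.exp_add, ← add_div]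
      exact exp_div_le_one_add hd0.le ht1
    have hmain : Real.exp (a / t) * (2 * A * laguerreFun k s) ≤ (1 + M / t) * (1 + N / t) :=
      calc _ ≤ Real.exp (a / t) * (Real.exp ((2 + s ^ 2) * s / 4 / t) * (1 + N / t)) := by gcongr
        _ = Real.exp (a / t) * Real.exp ((2 + s ^ 2) * s / 4 / t) * (1 + N / t) := by ring
        _ ≤ _ := by gcongr
    have hMN : M / t * (N / t) ≤ M * N / t := by
      rw [div_mul_div_comm]
      gcongr
      nlinarith
    linarith
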